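/- Let N be a submodule of an R-module M and suppose the ascending chain N ⊆ ⟨E_1(N)⟩ ⊆ ⟨E_2(N)⟩ ⊆ ⋯ terminates at ⟨E_n(N)⟩, i.e., ⟨E_{n+1}(N)⟩ = ⟨E_n(N)⟩ for some n ≥ 0. Then for every i ∈ {0, 1, 2, …, n}, the semiprime radical S(⟨E_i(N)⟩) = ⟨E_n(N)⟩ (where ⟨E_0(N)⟩ = N); that is, the semiprime radical is an invariant on the submodules generated by the envelopes in the finite chain. -/

import Mathlib

open Submodule

universe u v

/-- The envelope `E_M(N)` of a submodule `N` of `M`: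
the set of elements `a • m` with `a ^ k • m ∈ N` for some positive integer `k`. -/
def envSet {R : Type u} [CommRing R] {M : Type v} [AddCommGroup M] [Module R M]
    (N : Submodule R M) : Set M :=
  {x | ∃ (a : R) (m : M) (k : ℕ), 0 < k ∧ a ^ k • m ∈ N ∧ x = a • m}

/-- The submodule `⟨E_M(N)⟩` generated by the envelope of `N`. -/
def envSub {R : Type u} [CommRing R] {M : Type v} [AddCommGroup M] [Module R M]
    (N : Submodule R M) : Submodule R M :=
  Submodule.span R (envSet N)

/-- `chainSub N n = ⟨E_n(N)⟩`: the ascending chain with `⟨E_0(N)⟩ = N` and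
`⟨E_{n+1}(N)⟩ = ⟨E_M(⟨E_n(N)⟩)⟩`. -/
def chainSub {R : Type u} [CommRing R] {M : Type v} [AddCommGroup M] [Module R M]
    (N : Submodule R M) : ℕ → Submodule R M
  | 0 => N
  | n + 1 => envSub (chainSub N n)

/-- A proper submodule `K` is semiprime if `a ^ 2 • m ∈ K` implies `a • m ∈ K`. -/
def IsSemiprimeSub {R : Type u} [CommRing R] {M : Type v} [AddCommGroup M] [Module R M]
    (K : Submodule R M) : Prop :=
  K ≠ ⊤ ∧ ∀ (a : R) (m : M), a ^ 2 • m ∈ K → a • m ∈ K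

/-- The semiprime radical `S(N)`: the intersection of all semiprime submodules containing `N`. -/
def spRadical {R : Type u} [CommRing R] {M : Type v} [AddCommGroup M] [Module R M]
    (N : Submodule R M) : Submodule R M :=
  sInf {K | IsSemiprimeSub K ∧ N ≤ K}

/-- A proper submodule `P` is prime if `a • m ∈ P` implies `m ∈ P` or `a • M ⊆ P`. -/
def IsPrimeSub {R : Type u} [CommRing R] {M : Type v} [AddCommGroup M] [Module R M]
    (P : Submodule R M) : Prop :=
  P ≠ ⊤ ∧ ∀ (a : R) (m : M), a • m ∈ P → m ∈ P ∨ ∀ x : M, a • x ∈ P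

/-- The prime radical `β(N)`: the intersection of all prime submodules containing `N`. -/
def primeRadical {R : Type u} [CommRing R] {M : Type v} [AddCommGroup M] [Module R M]
    (N : Submodule R M) : Submodule R M :=
  sInf {P | IsPrimeSub P ∧ N ≤ P}

/-- `Γ_a(M) = {m : a ^ k • m = 0 for some positive integer k}`. -/
def Gamma {R : Type u} [CommRing R] {M : Type v} [AddCommGroup M] [Module R M]
    (a : R) : Submodule R M where
  carrier := {m | ∃ k : ℕ, 0 < k ∧ a ^ k • m = 0}
  zero_mem' := ⟨1, one_pos, smul_zero _⟩
  add_mem' := by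
    rintro x y ⟨k, hk, hx⟩ ⟨l, hl, hy⟩
    refine ⟨k + l, by omega, ?_⟩
    have h1 : a ^ (k + l) • x = 0 := by rw [pow_add, mul_comm, mul_smul, hx, smul_zero]
    have h2 : a ^ (k + l) • y = 0 := by rw [pow_add, mul_smul, hy, smul_zero]
    rw [smul_add, h1, h2, add_zero]
  smul_mem' := by
    rintro c x ⟨k, hk, hx⟩
    exact ⟨k, hk, by rw [smul_comm, hx, smul_zero]⟩

/-- `aΓ_a(M)`: the image of `Γ_a(M)` under multiplication by `a`. -/
def aGamma {R : Type u} [CommRing R] {M : Type v} [AddCommGroup M] [Module R M]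
    (a : R) : Submodule R M :=
  (Gamma (M := M) a).map (LinearMap.lsmul R M a)

/-- An element `m` of an `R`-module is nilpotent if `m = Σ_{i=1}^r a_i • m_i` with
`a_i ^ k • m_i = 0` for all `i`, for some positive integers `r`, `k`. -/
def IsNilpotentElem (R : Type u) [CommRing R] {M : Type v} [AddCommGroup M] [Module R M]
    (m : M) : Prop :=
  ∃ (r : ℕ) (a : Fin r → R) (x : Fin r → M) (k : ℕ),
    0 < r ∧ 0 < k ∧ m = ∑ i, a i • x i ∧ ∀ i, (a i) ^ k • x i = 0

/-- A reduced module: `a ^ k • m = 0` (for some positive `k`) implies `a • m = 0`,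
i.e. `E_M(0) = 0`. -/
def IsReducedModule (R : Type u) [CommRing R] (M : Type v) [AddCommGroup M] [Module R M] : Prop :=
  ∀ (a : R) (m : M) (k : ℕ), 0 < k → a ^ k • m = 0 → a • m = 0

theorem IsSemiprimeSub.smul_mem_of_pow_smul_mem {R : Type u} [CommRing R] {M : Type v}
    [AddCommGroup M] [Module R M] {K : Submodule R M} (hK : IsSemiprimeSub K) {a : R} {m : M}
    {k : ℕ} (hk : 0 < k) (h : a ^ k • m ∈ K) : a • m ∈ K := by
  induction k, hk using Nat.le_induction with
  | base => simpa using h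
  | succ k hk ih =>
    obtain ⟨j, rfl⟩ := Nat.exists_eq_add_of_le' hk
    refine ih ?_
    rw [pow_succ', mul_smul]
    refine hK.2 a _ ?_
    rwa [← mul_smul, ← pow_add, add_comm 2 j]

theorem le_envSub {R : Type u} [CommRing R] {M : Type v} [AddCommGroup M] [Module R M]
    (N : Submodule R M) : N ≤ envSub N := fun x hx =>
  subset_span ⟨1, x, 1, one_pos, by simpa using hx, (one_smul R x).symm⟩

theorem IsSemiprimeSub.envSub_le {R : Type u} [CommRing R] {M : Type v} [AddCommGroup M]
    [Module R M] {K N : Submodule R M} (hK : IsSemiprimeSub K) (hN : N ≤ K) : envSub N ≤ K := by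
  refine span_le.2 ?_
  rintro _ ⟨a, m, k, hk, h, rfl⟩
  exact hK.smul_mem_of_pow_smul_mem hk (hN h)

theorem chainSub_monotone {R : Type u} [CommRing R] {M : Type v} [AddCommGroup M] [Module R M]
    (N : Submodule R M) : Monotone (chainSub N) :=
  monotone_nat_of_le_succ fun n => le_envSub (chainSub N n)

theorem isSemiprimeSub_of_envSub_eq {R : Type u} [CommRing R] {M : Type v} [AddCommGroup M]
    [Module R M] {N : Submodule R M} (hN : N ≠ ⊤) (h : envSub N = N) : IsSemiprimeSub N :=
  ⟨hN, fun a m ham => h ▸ subset_span ⟨a, m, 2, two_pos, ham, rfl⟩⟩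

theorem IsSemiprimeSub.chainSub_le {R : Type u} [CommRing R] {M : Type v} [AddCommGroup M]
    [Module R M] {K N : Submodule R M} (hK : IsSemiprimeSub K) {i : ℕ} (hi : chainSub N i ≤ K)
    {n : ℕ} (hin : i ≤ n) : chainSub N n ≤ K := by
  induction n, hin using Nat.le_induction with
  | base => exact hi
  | succ n _ ih => exact hK.envSub_le ih

/-- If the chain `N ⊆ ⟨E_1(N)⟩ ⊆ ⟨E_2(N)⟩ ⊆ ⋯` terminates at `⟨E_n(N)⟩`,
then for every `i ∈ {0, 1, …, n}`, `S(⟨E_i(N)⟩) = ⟨E_n(N)⟩`. -/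
theorem stmt5 {R : Type u} [CommRing R] {M : Type v} [AddCommGroup M] [Module R M]
    (N : Submodule R M) (n : ℕ) (h : chainSub N (n + 1) = chainSub N n) :
    ∀ i ≤ n, spRadical (chainSub N i) = chainSub N n := by
  intro i hi
  refine le_antisymm ?_ (le_sInf fun K hK => hK.1.chainSub_le hK.2 hi)
  by_cases htop : chainSub N n = ⊤
  · exact htop ▸ le_top
  · exact sInf_le ⟨isSemiprimeSub_of_envSub_eq htop h, chainSub_monotone N hi⟩
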